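/- arXiv:2312.04464 — 2 statements merged into one kernel-verified Lean document; each statement's English description precedes it below -/
import Mathlib

section
/- Let 𝒳 be a set, F a class of real-valued functions on 𝒳, λ > 0, and σ_min, γ > 0. Let {σ_t}_{t∈[T]} and {β_t}_{t∈[T]} be sequences of non-negative reals, {X_t}_{t∈[T]} ⊆ 𝒳, and define {σ̄_t}_{t∈[T]} recursively by σ̄_t² = max{ σ_t², σ_min², γ² · D_F(X_t; X_{[t−1]}, σ̄_{[t−1]}) }. Then Σ_{t=1}^T min{ 1, β_t · D_F(X_t; X_{[t−1]}, σ̄_{[t−1]}) } ≤ dim_F(σ_min, T) + (max_{t∈[T]} β_t) · γ² · dim_F(σ_min, T) + √(dim_F(σ_min, T)) · √( Σ_{t=1}^T β_t² (σ_t² + σ_min²) ). -/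
/-- The set of ratios whose supremum defines the squared uncertainty
`D²_F(x; X_[n], σ_[n])`. -/
def uncSet {𝒳 : Type*} (F : Set (𝒳 → ℝ)) (lam : ℝ) (xs : ℕ → 𝒳) (sig : ℕ → ℝ)
    (n : ℕ) (x : 𝒳) : Set ℝ :=
  { r | ∃ f₁ ∈ F, ∃ f₂ ∈ F,
      r = (f₁ x - f₂ x) ^ 2 /
        ((∑ s ∈ Finset.Icc 1 n, (sig s ^ 2)⁻¹ * (f₁ (xs s) - f₂ (xs s)) ^ 2) + lam) }

/-- Squared uncertainty `D²_F(x; X_[n], σ_[n])`. -/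
noncomputable def uncertaintySq {𝒳 : Type*} (F : Set (𝒳 → ℝ)) (lam : ℝ)
    (xs : ℕ → 𝒳) (sig : ℕ → ℝ) (n : ℕ) (x : 𝒳) : ℝ :=
  sSup (uncSet F lam xs sig n x)

/-- Generalized Eluder dimension `dim_F(σ_min, T)`: the supremum over all sequences
`X_1, …, X_T` and weights `σ_t ≥ σ_min` of `Σ_t min{1, σ_t⁻² D²_F(X_t; X_[t-1], σ_[t-1])}`. -/
noncomputable def eluderDim {𝒳 : Type*} (F : Set (𝒳 → ℝ)) (lam smin : ℝ) (T : ℕ) : ℝ :=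
  ⨆ p : (ℕ → 𝒳) × {s : ℕ → ℝ // ∀ t, smin ≤ s t},
    ∑ t ∈ Finset.Icc 1 T,
      min 1 ((p.2.1 t ^ 2)⁻¹ * uncertaintySq F lam p.1 p.2.1 (t - 1) (p.1 t))

theorem uncertaintySq_nonneg {𝒳 : Type*} (F : Set (𝒳 → ℝ)) {lam : ℝ} (hlam : 0 ≤ lam)
    (xs : ℕ → 𝒳) (sig : ℕ → ℝ) (n : ℕ) (x : 𝒳) : 0 ≤ uncertaintySq F lam xs sig n x := by
  apply Real.sSup_nonneg
  rintro r ⟨f₁, -, f₂, -, rfl⟩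
  positivity

/-- The uncertainty depends only on the weights of the first `n` points. -/
theorem uncertaintySq_congr {𝒳 : Type*} (F : Set (𝒳 → ℝ)) (lam : ℝ) (xs : ℕ → 𝒳)
    {sig sig' : ℕ → ℝ} {n : ℕ} (h : ∀ s ∈ Finset.Icc 1 n, sig s = sig' s) (x : 𝒳) :
    uncertaintySq F lam xs sig n x = uncertaintySq F lam xs sig' n x := by
  have hsum (f₁ f₂ : 𝒳 → ℝ) :
      ∑ s ∈ Finset.Icc 1 n, (sig s ^ 2)⁻¹ * (f₁ (xs s) - f₂ (xs s)) ^ 2 =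
        ∑ s ∈ Finset.Icc 1 n, (sig' s ^ 2)⁻¹ * (f₁ (xs s) - f₂ (xs s)) ^ 2 :=
    Finset.sum_congr rfl fun s hs => by rw [h s hs]
  simp only [uncertaintySq, uncSet, hsum]

/-- It suffices that the weights of the first `T` points are at least `smin` for the sum of
truncated uncertainties to be bounded by the generalized Eluder dimension. -/
theorem sum_min_uncertaintySq_le_eluderDim {𝒳 : Type*} (F : Set (𝒳 → ℝ)) (lam smin : ℝ) (T : ℕ)
    (xs : ℕ → 𝒳) (sig : ℕ → ℝ) (hsig : ∀ t ∈ Finset.Icc 1 T, smin ≤ sig t)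
    (hdimbdd : BddAbove (Set.range
      fun p : (ℕ → 𝒳) × {s : ℕ → ℝ // ∀ t, smin ≤ s t} =>
        ∑ t ∈ Finset.Icc 1 T,
          min 1 ((p.2.1 t ^ 2)⁻¹ * uncertaintySq F lam p.1 p.2.1 (t - 1) (p.1 t)))) :
    ∑ t ∈ Finset.Icc 1 T, min 1 ((sig t ^ 2)⁻¹ * uncertaintySq F lam xs sig (t - 1) (xs t)) ≤
      eluderDim F lam smin T := by
  refine le_of_eq_of_le (Finset.sum_congr rfl fun t ht => ?_)
    (le_ciSup hdimbdd (xs, ⟨fun t => max (sig t) smin, fun t => le_max_right _ _⟩))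
  have hcongr : ∀ s ∈ Finset.Icc 1 (t - 1), sig s = max (sig s) smin := fun s hs =>
    (max_eq_left (hsig s (by simp only [Finset.mem_Icc] at hs ht ⊢; omega))).symm
  dsimp only
  rw [max_eq_left (hsig t ht), uncertaintySq_congr F lam xs hcongr]

/-- Bound on a single bonus: here `u` is the squared uncertainty, `b` the weight given by the
recursion, `s` and `m` the lower bounds on it. -/
theorem min_bonus_le {u b s m g β B : ℝ} (hu : 0 ≤ u) (hb : 0 < b) (hβ : 0 ≤ β) (hβB : β ≤ B)
    (h : b ^ 2 = max (s ^ 2) (max (m ^ 2) (g ^ 2 * √u))) :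
    min 1 (β * √u) ≤ min 1 ((b ^ 2)⁻¹ * u) + B * g ^ 2 * min 1 ((b ^ 2)⁻¹ * u) +
      √(min 1 ((b ^ 2)⁻¹ * u)) * (β * √(s ^ 2 + m ^ 2)) := by
  have hB : 0 ≤ B := hβ.trans hβB
  rcases le_total 1 ((b ^ 2)⁻¹ * u) with h1 | h1
  · rw [min_eq_left h1]
    have : 0 ≤ B * g ^ 2 * 1 + √1 * (β * √(s ^ 2 + m ^ 2)) := by positivity
    linarith [min_le_left 1 (β * √u)]
  rw [min_eq_right h1]
  refine (min_le_right _ _).trans ?_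
  have hw : 0 ≤ (b ^ 2)⁻¹ * u := by positivity
  by_cases hcase : b ^ 2 = g ^ 2 * √u
  · have hlin : √u = g ^ 2 * ((b ^ 2)⁻¹ * u) := by
      have : 0 < b ^ 2 := by positivity
      field_simp
      rw [hcase]
      nlinarith [Real.sq_sqrt hu]
    have hle : β * √u ≤ B * g ^ 2 * ((b ^ 2)⁻¹ * u) := by
      rw [mul_assoc, ← hlin]
      gcongr
    have : 0 ≤ √((b ^ 2)⁻¹ * u) * (β * √(s ^ 2 + m ^ 2)) := by positivity
    linarith
  · have hb2 : b ^ 2 ≤ s ^ 2 + m ^ 2 := by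
      rcases max_choice (s ^ 2) (max (m ^ 2) (g ^ 2 * √u)) with h2 | h2
      · nlinarith
      · rcases max_choice (m ^ 2) (g ^ 2 * √u) with h3 | h3
        · nlinarith
        · exact absurd (h.trans (h2.trans h3)) hcase
    have hroot : √u ≤ √((b ^ 2)⁻¹ * u) * √(s ^ 2 + m ^ 2) := by
      rw [← Real.sqrt_mul hw]
      apply Real.sqrt_le_sqrt
      calc u = (b ^ 2)⁻¹ * u * b ^ 2 := by field_simp
        _ ≤ _ := by gcongr
    have := mul_le_mul_of_nonneg_left hroot hβ
    have : 0 ≤ B * g ^ 2 * ((b ^ 2)⁻¹ * u) := by positivity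
    linarith

/-- Lemma on the weighted sum of bonuses: with
`σ̄_t² = max{σ_t², σ_min², γ² D_F(X_t; X_[t-1], σ̄_[t-1])}`, the sum
`Σ_t min{1, β_t D_F(X_t; X_[t-1], σ̄_[t-1])}` is bounded by
`dim_F + (max_t β_t) γ² dim_F + √dim_F √(Σ_t β_t²(σ_t² + σ_min²))`. -/
theorem sum_min_bonus_le
    {𝒳 : Type*} [Nonempty 𝒳] (F : Set (𝒳 → ℝ)) (lam : ℝ) (hlam : 0 < lam)
    (smin γ : ℝ) (hsmin : 0 < smin) (hγ : 0 < γ)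
    (T : ℕ) (hT : 1 ≤ T)
    (σ β : ℕ → ℝ) (hσ : ∀ t, 0 ≤ σ t) (hβ : ∀ t, 0 ≤ β t)
    (xs : ℕ → 𝒳) (bsig : ℕ → ℝ) (hbsigpos : ∀ t, 0 < bsig t)
    (hbar : ∀ t ∈ Finset.Icc 1 T, bsig t ^ 2 =
      max (σ t ^ 2) (max (smin ^ 2)
        (γ ^ 2 * Real.sqrt (uncertaintySq F lam xs bsig (t - 1) (xs t)))))
    (hbdd : ∀ n x, BddAbove (uncSet F lam xs bsig n x))
    (hdimbdd : BddAbove (Set.range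
      fun p : (ℕ → 𝒳) × {s : ℕ → ℝ // ∀ t, smin ≤ s t} =>
        ∑ t ∈ Finset.Icc 1 T,
          min 1 ((p.2.1 t ^ 2)⁻¹ * uncertaintySq F lam p.1 p.2.1 (t - 1) (p.1 t)))) :
    ∑ t ∈ Finset.Icc 1 T,
        min 1 (β t * Real.sqrt (uncertaintySq F lam xs bsig (t - 1) (xs t)))
      ≤ eluderDim F lam smin T
        + ((Finset.Icc 1 T).sup' (Finset.nonempty_Icc.mpr hT) β) * γ ^ 2 *
            eluderDim F lam smin T
        + Real.sqrt (eluderDim F lam smin T) *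
            Real.sqrt (∑ t ∈ Finset.Icc 1 T, β t ^ 2 * (σ t ^ 2 + smin ^ 2)) := by
  set w : ℕ → ℝ := fun t => min 1 ((bsig t ^ 2)⁻¹ * uncertaintySq F lam xs bsig (t - 1) (xs t))
  set B := (Finset.Icc 1 T).sup' (Finset.nonempty_Icc.mpr hT) β
  have hβB : ∀ t ∈ Finset.Icc 1 T, β t ≤ B := fun t ht => Finset.le_sup' β ht
  have hB : 0 ≤ B := (hβ 1).trans (hβB 1 (by simpa using hT))
  have hu (t : ℕ) := uncertaintySq_nonneg F hlam.le xs bsig (t - 1) (xs t)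
  have hw0 (t : ℕ) : 0 ≤ w t :=
    le_min zero_le_one (mul_nonneg (by positivity) (hu t))
  have hsig : ∀ t ∈ Finset.Icc 1 T, smin ≤ bsig t := fun t ht =>
    (sq_le_sq₀ hsmin.le (hbsigpos t).le).mp <|
      hbar t ht ▸ (le_max_left _ _).trans (le_max_right _ _)
  have hdim : ∑ t ∈ Finset.Icc 1 T, w t ≤ eluderDim F lam smin T :=
    sum_min_uncertaintySq_le_eluderDim F lam smin T xs bsig hsig hdimbdd
  calc _ ≤ ∑ t ∈ Finset.Icc 1 T,
          (w t + B * γ ^ 2 * w t + √(w t) * (β t * √(σ t ^ 2 + smin ^ 2))) :=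
        Finset.sum_le_sum fun t ht =>
          min_bonus_le (hu t) (hbsigpos t) (hβ t) (hβB t ht) (hbar t ht)
    _ = ∑ t ∈ Finset.Icc 1 T, w t + B * γ ^ 2 * ∑ t ∈ Finset.Icc 1 T, w t +
          ∑ t ∈ Finset.Icc 1 T, √(w t) * √(β t ^ 2 * (σ t ^ 2 + smin ^ 2)) := by
        simp only [Finset.sum_add_distrib, Finset.mul_sum, Real.sqrt_mul (sq_nonneg _),
          Real.sqrt_sq (hβ _)]
    _ ≤ ∑ t ∈ Finset.Icc 1 T, w t + B * γ ^ 2 * ∑ t ∈ Finset.Icc 1 T, w t +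
          √(∑ t ∈ Finset.Icc 1 T, w t) *
            √(∑ t ∈ Finset.Icc 1 T, β t ^ 2 * (σ t ^ 2 + smin ^ 2)) := by
        gcongr
        exact Real.sum_sqrt_mul_sqrt_le _ hw0 fun t => by positivity
    _ ≤ _ := by gcongr
end

section
/- Elliptical potential lemma: Let λ > 0, L > 0, and let x_1, …, x_T ∈ ℝ^d with ‖x_t‖₂ ≤ L for all t ∈ [T]. Define Σ_t = Σ_{s=1}^t x_s x_sᵀ + λ I_d (so Σ_0 = λ I_d). Then Σ_{t=1}^T min{ 1, ‖x_t‖²_{Σ_{t−1}^{−1}} } ≤ 2 d · log( 1 + T L² / (d λ) ), where ‖v‖²_A := vᵀ A v. -/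
open Matrix

/-- The **matrix determinant lemma** for a rank-one update. -/
theorem Matrix.det_add_vecMulVec_eq {n : Type*} [Fintype n] [DecidableEq n]
    {A : Matrix n n ℝ} (hA : IsUnit A.det) (u v : n → ℝ) :
    (A + vecMulVec u v).det = A.det * (1 + v ⬝ᵥ (A⁻¹ *ᵥ u)) := by
  have h : A + vecMulVec u v = A * (1 + vecMulVec (A⁻¹ *ᵥ u) v) := by
    rw [mul_add, mul_one, mul_vecMulVec, mulVec_mulVec, mul_nonsing_inv A hA, one_mulVec]
  rw [h, det_mul, vecMulVec_eq Unit, det_one_add_replicateCol_mul_replicateRow]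

/-- The AM-GM inequality for the eigenvalues of a positive definite matrix, in logarithmic form. -/
theorem Matrix.PosDef.log_det_le {n : Type*} [Fintype n] [DecidableEq n] [Nonempty n]
    {A : Matrix n n ℝ} (hA : A.PosDef) :
    Real.log A.det ≤ Fintype.card n * Real.log (A.trace / Fintype.card n) := by
  have hcard : (0 : ℝ) < Fintype.card n := by exact_mod_cast Fintype.card_pos
  have htr : 0 < A.trace := hA.trace_pos
  set m := A.trace / Fintype.card n with hm
  have hm0 : 0 < m := div_pos htr hcard
  have hdet : A.det = ∏ i, hA.1.eigenvalues i := by simpa using hA.1.det_eq_prod_eigenvalues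
  have htrace : A.trace = ∑ i, hA.1.eigenvalues i := by simpa using hA.1.trace_eq_sum_eigenvalues
  have key : ∀ i, Real.log (hA.1.eigenvalues i) ≤ Real.log m + (hA.1.eigenvalues i / m - 1) := by
    intro i
    have h := Real.log_le_sub_one_of_pos (div_pos (hA.eigenvalues_pos i) hm0)
    rw [Real.log_div (hA.eigenvalues_pos i).ne' hm0.ne'] at h
    linarith
  have hsum : A.trace / m = Fintype.card n := by rw [hm]; field_simp
  rw [hdet, Real.log_prod fun i _ => (hA.eigenvalues_pos i).ne']
  refine (Finset.sum_le_sum fun i _ => key i).trans (le_of_eq ?_)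
  rw [Finset.sum_add_distrib, Finset.sum_sub_distrib, ← Finset.sum_div, ← htrace, hsum]
  simp

theorem Real.min_one_le_two_mul_log_one_add {u : ℝ} (hu : 0 ≤ u) :
    min 1 u ≤ 2 * Real.log (1 + u) := by
  have h := Real.le_log_one_add_of_nonneg hu
  suffices min 1 u ≤ 2 * (2 * u / (u + 2)) by linarith
  rw [← mul_div_assoc, le_div_iff₀ (by linarith)]
  rcases le_total u 1 with h1 | h1
  · rw [min_eq_right h1]; nlinarith
  · rw [min_eq_left h1]; linarith

/-- The regularized Gram matrix of `x 1, …, x t`. -/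
noncomputable def regGram {n : Type*} [DecidableEq n] (lam : ℝ) (x : ℕ → n → ℝ) (t : ℕ) :
    Matrix n n ℝ :=
  ∑ s ∈ Finset.Icc 1 t, vecMulVec (x s) (x s) + lam • (1 : Matrix n n ℝ)

theorem regGram_succ {n : Type*} [DecidableEq n] (lam : ℝ) (x : ℕ → n → ℝ) (t : ℕ) :
    regGram lam x (t + 1) = regGram lam x t + vecMulVec (x (t + 1)) (x (t + 1)) := by
  rw [regGram, regGram, Finset.sum_Icc_succ_top (by omega)]
  abel

section

variable {n : Type*} [Fintype n] [DecidableEq n]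

theorem posDef_regGram {lam : ℝ} (hlam : 0 < lam) (x : ℕ → n → ℝ) (t : ℕ) :
    (regGram lam x t).PosDef := by
  refine PosDef.posSemidef_add (posSemidef_sum _ fun s _ => ?_) (PosDef.one.smul hlam)
  simpa using posSemidef_vecMulVec_self_star (x s)

theorem trace_regGram (lam : ℝ) (x : ℕ → n → ℝ) (t : ℕ) :
    (regGram lam x t).trace = ∑ s ∈ Finset.Icc 1 t, x s ⬝ᵥ x s + lam * Fintype.card n := by
  simp [regGram, trace_sum, trace_vecMulVec]

/-- The potentials are controlled by the growth of the log-determinant. -/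
theorem sum_min_one_le_log_det_regGram {lam : ℝ} (hlam : 0 < lam) (x : ℕ → n → ℝ) (T : ℕ) :
    ∑ t ∈ Finset.Icc 1 T, min 1 (x t ⬝ᵥ ((regGram lam x (t - 1))⁻¹ *ᵥ x t)) ≤
      2 * (Real.log (regGram lam x T).det - Fintype.card n * Real.log lam) := by
  induction T with
  | zero => simp [regGram]
  | succ T ih =>
    have hA := posDef_regGram hlam x T
    have hu : 0 ≤ x (T + 1) ⬝ᵥ ((regGram lam x T)⁻¹ *ᵥ x (T + 1)) := by
      simpa using hA.inv.posSemidef.dotProduct_mulVec_nonneg (x (T + 1))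
    rw [Finset.sum_Icc_succ_top (by omega), Nat.add_sub_cancel, regGram_succ,
      det_add_vecMulVec_eq hA.det_pos.ne'.isUnit,
      Real.log_mul hA.det_pos.ne' (by linarith)]
    linarith [Real.min_one_le_two_mul_log_one_add hu]

end



/-- Elliptical potential lemma: for `x_1, …, x_T ∈ ℝ^d` with
`‖x_t‖₂ ≤ L` and `Σ_t = Σ_{s≤t} x_s x_sᵀ + λ I`,
`Σ_{t=1}^T min{1, ‖x_t‖²_{Σ_{t-1}⁻¹}} ≤ 2d log(1 + TL²/(dλ))`. -/
theorem elliptical_potential (d : ℕ) (hd : 0 < d) (lam L : ℝ)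
    (hlam : 0 < lam) (hL : 0 < L) (T : ℕ) (x : ℕ → Fin d → ℝ)
    (hx : ∀ t ∈ Finset.Icc 1 T, Real.sqrt (∑ i, x t i ^ 2) ≤ L) :
    ∑ t ∈ Finset.Icc 1 T,
        min 1 (x t ⬝ᵥ ((∑ s ∈ Finset.Icc 1 (t - 1), vecMulVec (x s) (x s)
            + lam • (1 : Matrix (Fin d) (Fin d) ℝ))⁻¹ *ᵥ x t))
      ≤ 2 * d * Real.log (1 + T * L ^ 2 / (d * lam)) := by
  have hd' : (0 : ℝ) < d := by exact_mod_cast hd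
  have : Nonempty (Fin d) := ⟨⟨0, hd⟩⟩
  have hA := posDef_regGram hlam x T
  have hlog := hA.log_det_le
  have htr : (regGram lam x T).trace ≤ T * L ^ 2 + lam * d := by
    have hnorm : ∀ t ∈ Finset.Icc 1 T, x t ⬝ᵥ x t ≤ L ^ 2 := by
      intro t ht
      simpa [dotProduct, sq] using (Real.sqrt_le_left hL.le).1 (hx t ht)
    rw [trace_regGram, Fintype.card_fin]
    simpa using Finset.sum_le_card_nsmul _ _ _ hnorm
  have hmono : Real.log ((regGram lam x T).trace / d) ≤
      Real.log lam + Real.log (1 + T * L ^ 2 / (d * lam)) := by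
    rw [← Real.log_mul hlam.ne' (by positivity)]
    refine Real.log_le_log (div_pos hA.trace_pos hd') ?_
    rw [div_le_iff₀ hd']
    refine htr.trans (le_of_eq ?_)
    field_simp
    ring
  rw [Fintype.card_fin] at hlog
  have hsum := sum_min_one_le_log_det_regGram hlam x T
  rw [Fintype.card_fin] at hsum
  refine hsum.trans ?_
  linarith [mul_le_mul_of_nonneg_left hmono hd'.le]
end
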